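/- Let Γ be a geometric distance-regular graph with classical parameters (D, b, α, β) such that b ≥ 2, 1 ≤ α ≤ b−1 and D ≥ 3, with line set 𝓒, and let r = [D]. Assume Γ satisfies the dual Pasch axiom. Then each pair of adjacent vertices x, y lies in a unique assembly M_{x,y}, each assembly has exactly αr + 1 vertices, and consequently β ≥ αr and every vertex of Γ lies in exactly β/α assemblies. -/

import Mathlib

open SimpleGraph

namespace DRGPaper

variable {V : Type*}

/-- `Γ` is a distance-regular graph with diameter `D` and intersection arrays `cc`, `aa`, `bb`:
`Γ` is connected of diameter `D` and for any vertices `x, y` at distance `i ≤ D`, `y` has exactly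
`cc i` neighbours at distance `i - 1` from `x`, `aa i` neighbours at distance `i` from `x`,
and `bb i` neighbours at distance `i + 1` from `x`. -/
def IsDRG [Fintype V] (G : SimpleGraph V) (D : ℕ) (cc aa bb : ℕ → ℕ) : Prop :=
  G.Connected ∧
  (∀ x y : V, G.dist x y ≤ D) ∧
  (∃ x y : V, G.dist x y = D) ∧
  ∀ i : ℕ, i ≤ D → ∀ x y : V, G.dist x y = i →
    {z : V | G.Adj y z ∧ G.dist x z = i - 1}.ncard = cc i ∧
    {z : V | G.Adj y z ∧ G.dist x z = i}.ncard = aa i ∧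
    {z : V | G.Adj y z ∧ G.dist x z = i + 1}.ncard = bb i

/-- `[j] = (b^j - 1)/(b - 1) = 1 + b + ⋯ + b^(j-1)` as a real number. -/
def gauss (b j : ℕ) : ℝ := ∑ i ∈ Finset.range j, (b : ℝ) ^ i

/-- `Γ` has classical parameters `(D, b, α, β)`: it is distance-regular of diameter `D` with
`bb i = ([D] - [i])(β - α[i])` for `0 ≤ i ≤ D - 1` and `cc i = [i](1 + α[i-1])` for
`1 ≤ i ≤ D`. -/
def HasClassicalParams [Fintype V] (G : SimpleGraph V) (D b : ℕ) (α β : ℝ)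
    (cc aa bb : ℕ → ℕ) : Prop :=
  IsDRG G D cc aa bb ∧
  (∀ i : ℕ, i ≤ D - 1 → (bb i : ℝ) = (gauss b D - gauss b i) * (β - α * gauss b i)) ∧
  (∀ i : ℕ, 1 ≤ i → i ≤ D → (cc i : ℝ) = gauss b i * (1 + α * gauss b (i - 1)))

/-- `d(x, C) = min {d(x, y) : y ∈ C}`. -/
noncomputable def distToSet (G : SimpleGraph V) (x : V) (C : Set V) : ℕ :=
  sInf (G.dist x '' C)

/-- A maximal clique of `G`. -/
def IsMaxClique (G : SimpleGraph V) (s : Set V) : Prop :=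
  G.IsClique s ∧ ∀ t : Set V, G.IsClique t → s ⊆ t → t = s

/-- The lines for the PLS(γ) property: maximal cliques with at least `γ` vertices. -/
def plsLines (G : SimpleGraph V) (γ : ℕ) : Set (Set V) :=
  {ℓ : Set V | IsMaxClique G ℓ ∧ γ ≤ ℓ.ncard}

/-- `G` is the point graph of the partial linear space with line set `L`: any two adjacent
vertices lie on exactly one common line of `L`. -/
def IsPointGraphOf (G : SimpleGraph V) (L : Set (Set V)) : Prop :=
  ∀ x y : V, G.Adj x y → ∃! ℓ : Set V, ℓ ∈ L ∧ x ∈ ℓ ∧ y ∈ ℓ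

/-- A vertex is a Delsarte vertex (w.r.t. the line set `L` and classical parameter `β`) if all
lines through it have exactly `β + 1` vertices. -/
def IsDelsarteVertex (L : Set (Set V)) (β : ℝ) (x : V) : Prop :=
  ∀ ℓ ∈ L, x ∈ ℓ → (ℓ.ncard : ℝ) = β + 1

/-- The lines for the SPLS(c, s) property: maximal cliques with at least
`a1 + 2 - (c - 1)(s - 1)` vertices. -/
def splsLines (G : SimpleGraph V) (a1 c s : ℕ) : Set (Set V) :=
  {ℓ : Set V | IsMaxClique G ℓ ∧ (a1 : ℤ) + 2 - ((c : ℤ) - 1) * ((s : ℤ) - 1) ≤ (ℓ.ncard : ℤ)}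

/-- The SPLS(c, s) property: `G` is the point graph of the partial linear space whose lines are
the maximal cliques with at least `a1 + 2 - (c-1)(s-1)` vertices, `a1 ≥ (2s-1)(c-1)`, each
vertex lies on at most `s` lines, and every point not on a line `ℓ` is collinear with at most
`c` points of `ℓ`.  SPLS(s) is the case `c = c₂`. -/
def HasSPLS (G : SimpleGraph V) (a1 c s : ℕ) : Prop :=
  1 ≤ c ∧ 2 ≤ s ∧
  (2 * (s : ℤ) - 1) * ((c : ℤ) - 1) ≤ (a1 : ℤ) ∧
  IsPointGraphOf G (splsLines G a1 c s) ∧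
  (∀ x : V, {ℓ ∈ splsLines G a1 c s | x ∈ ℓ}.ncard ≤ s) ∧
  (∀ ℓ ∈ splsLines G a1 c s, ∀ x : V, x ∉ ℓ → {y ∈ ℓ | G.Adj x y}.ncard ≤ c)

/-- `[x, y]`: the set of lines `ℓ ∈ L` through `x` such that `d(y, u) ≤ 2` for all `u ∈ ℓ`. -/
def lineXY (G : SimpleGraph V) (L : Set (Set V)) (x y : V) : Set (Set V) :=
  {ℓ ∈ L | x ∈ ℓ ∧ ∀ u ∈ ℓ, G.dist y u ≤ 2}

/-- `𝓒` witnesses that `G` is geometric with cliques of order `q`: every member of `𝓒` is a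
clique with exactly `q` vertices and every edge of `G` lies in a unique member of `𝓒`. -/
def IsGeomLineSet (G : SimpleGraph V) (q : ℝ) (𝓒 : Set (Set V)) : Prop :=
  (∀ C ∈ 𝓒, G.IsClique C ∧ (C.ncard : ℝ) = q) ∧
  ∀ x y : V, G.Adj x y → ∃! C : Set V, C ∈ 𝓒 ∧ x ∈ C ∧ y ∈ C

/-- `G` is geometric: there is a set of Delsarte cliques (cliques of the maximum order `q`)
such that every edge lies in a unique member. -/
def IsGeometric (G : SimpleGraph V) (q : ℝ) : Prop :=
  ∃ 𝓒 : Set (Set V), IsGeomLineSet G q 𝓒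

/-- An assembly: a maximal clique which is not a line. -/
def IsAssembly (G : SimpleGraph V) (𝓒 : Set (Set V)) (M : Set V) : Prop :=
  IsMaxClique G M ∧ M ∉ 𝓒

/-- The dual Pasch axiom: for every pair of adjacent vertices `x, y`, the common neighbours of
`x` and `y` outside the (any) line of `𝓒` through `x` and `y` form a clique. -/
def DualPasch (G : SimpleGraph V) (𝓒 : Set (Set V)) : Prop :=
  ∀ x y : V, G.Adj x y → ∀ ℓ ∈ 𝓒, x ∈ ℓ → y ∈ ℓ →
    G.IsClique {z : V | G.Adj x z ∧ G.Adj y z ∧ z ∉ ℓ}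

/-- The `m × n` grid, i.e. the Cartesian product `K_m □ K_n`. -/
def gridGraph (m n : ℕ) : SimpleGraph (Fin m × Fin n) :=
  (⊤ : SimpleGraph (Fin m)).boxProd (⊤ : SimpleGraph (Fin n))

/-- The `A`-clique extension of a graph `H`: replace every vertex of `H` by a clique of size
`A`, vertices in distinct cliques being adjacent exactly when the underlying vertices of `H`
are adjacent. -/
def cliqueExt {W : Type*} (H : SimpleGraph W) (A : ℕ) : SimpleGraph (W × Fin A) :=
  SimpleGraph.fromRel (fun p q => H.Adj p.1 q.1 ∨ p.1 = q.1)

/-- `θ` is an eigenvalue of the adjacency matrix of `G`. -/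
def IsAdjEigenvalue [Fintype V] (G : SimpleGraph V) [DecidableRel G.Adj] (θ : ℝ) : Prop :=
  ∃ v : V → ℝ, v ≠ 0 ∧ (G.adjMatrix ℝ).mulVec v = θ • v

/-- If the members of `𝓛` are cliques of order `q + 1` partitioning the edges, then the valency of
`x` is `q` times the number of members through `x`. -/
lemma degree_eq_mul_ncard_cliques [Finite V] {G : SimpleGraph V} {𝓛 : Set (Set V)} {q : ℝ}
    (hclique : ∀ L ∈ 𝓛, G.IsClique L) (hcard : ∀ L ∈ 𝓛, (L.ncard : ℝ) = q + 1)
    (hedge : IsPointGraphOf G 𝓛) (x : V) :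
    ({z | G.Adj x z}.ncard : ℝ) = q * {L | L ∈ 𝓛 ∧ x ∈ L}.ncard := by
  classical
  have := Fintype.ofFinite V
  have hN : {z | G.Adj x z}.toFinset =
      {L | L ∈ 𝓛 ∧ x ∈ L}.toFinset.biUnion fun L ↦ (L \ {x}).toFinset := by
    ext z
    simp only [Set.mem_toFinset, Set.mem_ofPred_eq, Finset.mem_biUnion, Set.mem_sdiff,
      Set.mem_singleton_iff]
    constructor
    · intro hz
      obtain ⟨L, ⟨hL, hxL, hzL⟩, -⟩ := hedge x z hz
      exact ⟨L, ⟨hL, hxL⟩, hzL, hz.ne'⟩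
    · rintro ⟨L, ⟨hL, hxL⟩, hzL, hzx⟩
      exact hclique L hL hxL hzL (Ne.symm hzx)
  rw [Set.ncard_eq_toFinset_card', Set.ncard_eq_toFinset_card', hN, Finset.card_biUnion]
  · push_cast
    rw [Finset.sum_congr rfl (g := fun _ ↦ q), Finset.sum_const, nsmul_eq_mul, mul_comm]
    intro L hL
    simp only [Set.mem_toFinset, Set.mem_ofPred_eq] at hL
    rw [← Set.ncard_eq_toFinset_card']
    have h1 := Set.ncard_sdiff_singleton_add_one hL.2 (Set.toFinite L)
    have h2 := hcard L hL.1
    rw [← h1] at h2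
    push_cast at h2
    linarith
  · intro L hL L' hL' hne
    simp only [Set.coe_toFinset, Set.mem_ofPred_eq] at hL hL'
    rw [Function.onFun, Finset.disjoint_left]
    intro z hz hz'
    simp only [Set.mem_toFinset, Set.mem_sdiff, Set.mem_singleton_iff] at hz hz'
    have hadj : G.Adj x z := hclique L hL.1 hL.2 hz.1 (Ne.symm hz.2)
    exact hne ((hedge x z hadj).unique ⟨hL.1, hL.2, hz.1⟩ ⟨hL'.1, hL'.2, hz'.1⟩)

open Classical in
/-- If `𝓛` is a set of cliques partitioning the edges with exactly `s` members through every
vertex, and `N` is the vertex-clique incidence matrix, then `N Nᵀ = A + s I`, evaluated here on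
an eigenvector `w` of the adjacency matrix `A`. -/
lemma sum_sq_cliques_eq [Fintype V] {G : SimpleGraph V} {𝓛 : Set (Set V)} {s θ : ℝ}
    (hclique : ∀ L ∈ 𝓛, G.IsClique L) (hedge : IsPointGraphOf G 𝓛)
    (hthrough : ∀ x, ({L | L ∈ 𝓛 ∧ x ∈ L}.ncard : ℝ) = s) {w : V → ℝ}
    (hw : ∀ x, ∑ y with G.Adj x y, w y = θ * w x) :
    ∑ L ∈ 𝓛.toFinset, (∑ x with x ∈ L, w x) ^ 2 = (s + θ) * ∑ x, w x ^ 2 := by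
  have hcount (x y : V) : ∑ L ∈ 𝓛.toFinset, (if x ∈ L ∧ y ∈ L then (1 : ℝ) else 0) =
      (if x = y then s else 0) + if G.Adj x y then 1 else 0 := by
    rw [Finset.sum_boole]
    by_cases hxy : x = y
    · subst hxy
      simp only [and_self, if_true, G.irrefl, if_false, add_zero]
      rw [← hthrough x, Set.ncard_eq_toFinset_card']
      congr 2
      ext L
      simp
    · by_cases hadj : G.Adj x y
      · obtain ⟨L, ⟨hL, hx, hy⟩, huniq⟩ := hedge x y hadj
        simp only [hxy, hadj, if_true, if_false, zero_add]
        rw [Nat.cast_eq_one, Finset.card_eq_one]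
        refine ⟨L, Finset.ext fun M ↦ ?_⟩
        simp only [Finset.mem_filter, Set.mem_toFinset, Finset.mem_singleton]
        exact ⟨huniq M, fun h ↦ h ▸ ⟨hL, hx, hy⟩⟩
      · simp only [hxy, hadj, if_false, add_zero]
        rw [Nat.cast_eq_zero, Finset.card_eq_zero, Finset.filter_eq_empty_iff]
        intro L hL hmem
        exact hadj (hclique L (Set.mem_toFinset.1 hL) hmem.1 hmem.2 hxy)
  calc ∑ L ∈ 𝓛.toFinset, (∑ x with x ∈ L, w x) ^ 2
      = ∑ L ∈ 𝓛.toFinset, ∑ x, ∑ y, w x * w y * (if x ∈ L ∧ y ∈ L then (1 : ℝ) else 0) := by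
        refine Finset.sum_congr rfl fun L _ ↦ ?_
        rw [sq, Finset.sum_filter, Finset.sum_mul_sum]
        refine Finset.sum_congr rfl fun x _ ↦ Finset.sum_congr rfl fun y _ ↦ ?_
        by_cases hx : x ∈ L <;> by_cases hy : y ∈ L <;> simp [hx, hy]
    _ = ∑ x, ∑ y, w x * w y * ((if x = y then s else 0) + if G.Adj x y then 1 else 0) := by
        rw [Finset.sum_comm]
        refine Finset.sum_congr rfl fun x _ ↦ ?_
        rw [Finset.sum_comm]
        refine Finset.sum_congr rfl fun y _ ↦ ?_
        rw [← hcount, Finset.mul_sum]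
    _ = ∑ x, (s * w x ^ 2 + w x * ∑ y with G.Adj x y, w y) := by
        refine Finset.sum_congr rfl fun x _ ↦ ?_
        simp only [mul_add, Finset.sum_add_distrib, mul_ite, mul_zero, mul_one,
          Finset.sum_ite_eq, Finset.mem_univ, if_true, Finset.mul_sum, Finset.sum_filter]
        ring
    _ = (s + θ) * ∑ x, w x ^ 2 := by
        rw [Finset.mul_sum]
        refine Finset.sum_congr rfl fun x _ ↦ ?_
        rw [hw]
        ring

lemma gauss_zero (b : ℕ) : gauss b 0 = 0 := by simp [gauss]

lemma gauss_one (b : ℕ) : gauss b 1 = 1 := by simp [gauss]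

lemma gauss_succ (b j : ℕ) : gauss b (j + 1) = gauss b j + (b : ℝ) ^ j :=
  Finset.sum_range_succ _ _

lemma gauss_mono (b : ℕ) : Monotone (gauss b) :=
  monotone_nat_of_le_succ fun j ↦ by rw [gauss_succ]; exact le_add_of_nonneg_right (by positivity)

lemma gauss_nonneg (b j : ℕ) : 0 ≤ gauss b j :=
  Finset.sum_nonneg fun _ _ ↦ by positivity

open Classical in
/-- Sums over the neighbours of `y` of a function of the distance to `x`. -/
lemma IsDRG.sum_adj_dist [Fintype V] {G : SimpleGraph V} {D : ℕ} {cc aa bb : ℕ → ℕ}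
    (h : IsDRG G D cc aa bb) (f : ℕ → ℝ) {x y : V} {i : ℕ} (hi : 1 ≤ i)
    (hxy : G.dist x y = i) :
    ∑ z with G.Adj y z, f (G.dist x z) =
      cc i * f (i - 1) + aa i * f i + bb i * f (i + 1) := by
  obtain ⟨hconn, hle, -, hreg⟩ := h
  obtain ⟨hc, ha, hb⟩ := hreg i (hxy ▸ hle x y) x y hxy
  have hsum (j : ℕ) : ({z : V | G.Adj y z ∧ G.dist x z = j}.ncard : ℝ) * f j =
      ∑ z with G.Adj y z, if G.dist x z = j then f j else 0 := by
    rw [← Finset.sum_filter, Finset.sum_const, nsmul_eq_mul, Set.ncard_eq_toFinset_card']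
    congr 2
    congr 1
    ext z
    simp
  rw [← hc, ← ha, ← hb, hsum, hsum, hsum, ← Finset.sum_add_distrib, ← Finset.sum_add_distrib]
  refine Finset.sum_congr rfl fun z hz ↦ ?_
  have hadj : G.Adj y z := (Finset.mem_filter.1 hz).2
  have h1 : G.dist x z ≤ G.dist x y + G.dist y z := hconn.dist_triangle
  have h2 : G.dist x y ≤ G.dist x z + G.dist z y := hconn.dist_triangle
  rw [dist_eq_one_iff_adj.2 hadj] at h1
  rw [dist_eq_one_iff_adj.2 hadj.symm] at h2
  have h3 : G.dist x z = i - 1 ∨ G.dist x z = i ∨ G.dist x z = i + 1 := by omega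
  rcases h3 with h3 | h3 | h3
  · have : i - 1 ≠ i := by omega
    have : i - 1 ≠ i + 1 := by omega
    simp [*]
  · have : i ≠ i - 1 := by omega
    simp [*]
  · have : i + 1 ≠ i - 1 := by omega
    simp [*]

section ClassicalParams

variable [Fintype V] {G : SimpleGraph V} {D b : ℕ} {α β : ℝ} {cc aa bb : ℕ → ℕ}

lemma HasClassicalParams.degree_eq (h : HasClassicalParams G D b α β cc aa bb) (x : V) :
    ({z | G.Adj x z}.ncard : ℝ) = gauss b D * β := by
  have h0 := (h.1.2.2.2 0 (Nat.zero_le _) x x dist_self).2.2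
  have h1 := h.2.1 0 (Nat.zero_le _)
  rw [gauss_zero, sub_zero, mul_zero, sub_zero, ← h0] at h1
  rw [← h1]
  congr 2
  ext z
  simp only [Set.mem_ofPred_eq, zero_add, dist_eq_one_iff_adj, and_self]

lemma HasClassicalParams.mul_gauss_lt (h : HasClassicalParams G D b α β cc aa bb) (hb : 0 < b)
    (hα : 0 ≤ α) {i : ℕ} (hi : i < D) : α * gauss b i < β := by
  obtain ⟨⟨-, -, ⟨x, y, hxy⟩, hreg⟩, hbb, hcc⟩ := h
  obtain ⟨n, rfl⟩ : ∃ n, D = n + 1 := ⟨D - 1, by omega⟩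
  have hpow : gauss b (n + 1) - gauss b n = (b : ℝ) ^ n := by rw [gauss_succ]; ring
  have hpos : (0 : ℝ) < (b : ℝ) ^ n := by positivity
  have hcpos : (0 : ℝ) < cc (n + 1) := by
    rw [hcc (n + 1) (by omega) le_rfl, Nat.add_sub_cancel]
    have := gauss_nonneg b n
    have : 0 < gauss b (n + 1) := by linarith
    positivity
  rw [← (hreg (n + 1) le_rfl x y hxy).1, Nat.cast_pos, Set.ncard_pos] at hcpos
  obtain ⟨z, hyz, hxz⟩ := hcpos
  rw [Nat.add_sub_cancel] at hxz
  have hbpos : (0 : ℝ) < bb n := by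
    rw [← (hreg n (by omega) x z hxz).2.2, Nat.cast_pos, Set.ncard_pos]
    exact ⟨y, hyz.symm, hxy⟩
  rw [hbb n (by omega), hpow] at hbpos
  have h1 := pos_of_mul_pos_right hbpos hpos.le
  have h2 := mul_le_mul_of_nonneg_left (gauss_mono b (show i ≤ n by omega)) hα
  linarith

lemma HasClassicalParams.bb_eq (h : HasClassicalParams G D b α β cc aa bb) {i : ℕ} (hi : i ≤ D) :
    (bb i : ℝ) = (gauss b D - gauss b i) * (β - α * gauss b i) := by
  rcases hi.lt_or_eq with hlt | rfl
  · exact h.2.1 i (by omega)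
  · obtain ⟨⟨-, hle, ⟨x, y, hxy⟩, hreg⟩, -⟩ := h
    rw [sub_self, zero_mul, ← (hreg i le_rfl x y hxy).2.2, Nat.cast_eq_zero, Set.ncard_eq_zero,
      Set.eq_empty_iff_forall_notMem]
    rintro z ⟨-, hz⟩
    have := hle x z
    omega

lemma HasClassicalParams.aa_eq (h : HasClassicalParams G D b α β cc aa bb) {x y : V} {i : ℕ}
    (hi : 1 ≤ i) (hxy : G.dist x y = i) :
    (aa i : ℝ) = gauss b D * β - (gauss b D - gauss b i) * (β - α * gauss b i) -
      gauss b i * (1 + α * gauss b (i - 1)) := by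
  classical
  have hiD : i ≤ D := hxy ▸ h.1.2.1 x y
  have hsum := h.1.sum_adj_dist (fun _ ↦ 1) hi hxy
  have hdeg := h.degree_eq y
  rw [Finset.sum_const, nsmul_eq_mul, h.bb_eq hiD, h.2.2 i hi hiD] at hsum
  rw [Set.ncard_eq_toFinset_card', Set.toFinset_ofPred] at hdeg
  linarith

/-- The cosine sequence of the smallest eigenvalue `-[D]`. -/
noncomputable def cosine (b : ℕ) (α β : ℝ) (i : ℕ) : ℝ :=
  ∏ j ∈ Finset.range i, (-(1 + α * gauss b j) / (β - α * gauss b j))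

lemma cosine_zero (b : ℕ) (α β : ℝ) : cosine b α β 0 = 1 := by simp [cosine]

lemma cosine_succ_mul {i : ℕ} (hi : α * gauss b i < β) :
    cosine b α β (i + 1) * (β - α * gauss b i) = -(1 + α * gauss b i) * cosine b α β i := by
  have : β - α * gauss b i ≠ 0 := (sub_pos.2 hi).ne'
  rw [cosine, Finset.prod_range_succ, ← cosine]
  field_simp

open Classical in
lemma HasClassicalParams.sum_adj_cosine (h : HasClassicalParams G D b α β cc aa bb) (hb : 0 < b)
    (hD : 0 < D) (hα : 0 ≤ α) (x y : V) :
    ∑ z with G.Adj y z, cosine b α β (G.dist x z) =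
      -gauss b D * cosine b α β (G.dist x y) := by
  rcases Nat.eq_zero_or_pos (G.dist x y) with h0 | hpos
  · obtain rfl : x = y := h.1.1.dist_eq_zero_iff.1 h0
    have hβ := h.mul_gauss_lt hb hα hD
    have h1 := cosine_succ_mul hβ
    rw [gauss_zero, mul_zero, sub_zero, cosine_zero, zero_add] at h1
    have hdeg := h.degree_eq x
    rw [Set.ncard_eq_toFinset_card', Set.toFinset_ofPred] at hdeg
    rw [Finset.sum_congr rfl (g := fun _ ↦ cosine b α β 1), Finset.sum_const, nsmul_eq_mul, hdeg,
      h0, cosine_zero]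
    · linear_combination gauss b D * h1
    · intro z hz
      rw [dist_eq_one_iff_adj.2 (Finset.mem_filter.1 hz).2]
  · obtain ⟨i, hi⟩ : ∃ i, G.dist x y = i + 1 := ⟨G.dist x y - 1, by omega⟩
    have hiD : i + 1 ≤ D := hi ▸ h.1.2.1 x y
    rw [h.1.sum_adj_dist _ (Nat.le_add_left 1 i) hi, h.aa_eq (Nat.le_add_left 1 i) hi,
      h.bb_eq hiD, h.2.2 _ (Nat.le_add_left 1 i) hiD, hi, Nat.add_sub_cancel]
    have h1 := cosine_succ_mul (h.mul_gauss_lt hb hα (show i < D by omega))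
    have h2 : (gauss b D - gauss b (i + 1)) *
        (cosine b α β (i + 1 + 1) * (β - α * gauss b (i + 1)) +
          (1 + α * gauss b (i + 1)) * cosine b α β (i + 1)) = 0 := by
      rcases hiD.lt_or_eq with hlt | heq
      · rw [cosine_succ_mul (h.mul_gauss_lt hb hα hlt)]
        ring
      · rw [heq, sub_self, zero_mul]
    linear_combination h2 + gauss b (i + 1) * h1

variable {𝓒 : Set (Set V)} {ℓ : Set V}

lemma HasClassicalParams.ncard_lines_through (h : HasClassicalParams G D b α β cc aa bb)
    (hgeo : IsGeomLineSet G (β + 1) 𝓒) (hβ : 0 < β) (x : V) :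
    ({L | L ∈ 𝓒 ∧ x ∈ L}.ncard : ℝ) = gauss b D := by
  have h1 := degree_eq_mul_ncard_cliques (fun L hL ↦ (hgeo.1 L hL).1)
    (fun L hL ↦ (hgeo.1 L hL).2) hgeo.2 x
  rw [h.degree_eq, mul_comm] at h1
  exact (mul_left_cancel₀ hβ.ne' h1).symm

open Classical in
lemma HasClassicalParams.sum_line_cosine (h : HasClassicalParams G D b α β cc aa bb)
    (hgeo : IsGeomLineSet G (β + 1) 𝓒) (hb : 0 < b) (hD : 0 < D) (hα : 0 ≤ α)
    (hℓ : ℓ ∈ 𝓒) (x : V) : ∑ z with z ∈ ℓ, cosine b α β (G.dist x z) = 0 := by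
  have hβ : 0 < β := by simpa [gauss_zero] using h.mul_gauss_lt hb hα hD
  have hsum := sum_sq_cliques_eq (fun L hL ↦ (hgeo.1 L hL).1) hgeo.2
    (h.ncard_lines_through hgeo hβ) (h.sum_adj_cosine hb hD hα x)
  rw [add_neg_cancel, zero_mul, Finset.sum_eq_zero_iff_of_nonneg fun _ _ ↦ sq_nonneg _] at hsum
  exact pow_eq_zero_iff two_ne_zero |>.1 (hsum ℓ (Set.mem_toFinset.2 hℓ))

/-- A vertex at distance one from a line has exactly `1 + α` neighbours on it. -/
lemma HasClassicalParams.ncard_adj_line (h : HasClassicalParams G D b α β cc aa bb)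
    (hgeo : IsGeomLineSet G (β + 1) 𝓒) (hb : 0 < b) (hD : 2 ≤ D) (hα : 0 ≤ α)
    (hℓ : ℓ ∈ 𝓒) {z p : V} (hz : z ∉ ℓ) (hp : p ∈ ℓ) (hzp : G.Adj z p) :
    ({w | w ∈ ℓ ∧ G.Adj z w}.ncard : ℝ) = 1 + α := by
  classical
  obtain ⟨hclique, hcard⟩ := hgeo.1 ℓ hℓ
  have hβ : α * gauss b 0 < β := h.mul_gauss_lt hb hα (by omega)
  have hβα : α * gauss b 1 < β := h.mul_gauss_lt hb hα (by omega)
  have hu1 := cosine_succ_mul hβ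
  have hu2 := cosine_succ_mul hβα
  rw [gauss_zero, mul_zero] at hβ
  rw [gauss_one, mul_one] at hβα
  simp only [gauss_zero, mul_zero, sub_zero, cosine_zero, zero_add, add_zero, mul_one] at hu1
  simp only [gauss_one, mul_one, Nat.reduceAdd] at hu2
  have hdist (w : V) (hw : w ∈ ℓ) (hadj : ¬G.Adj z w) : G.dist z w = 2 := by
    have hpw : G.Adj p w := hclique hp hw (by rintro rfl; exact hadj hzp)
    have h1 : G.dist z w ≤ G.dist z p + G.dist p w := h.1.1.dist_triangle
    rw [dist_eq_one_iff_adj.2 hzp, dist_eq_one_iff_adj.2 hpw] at h1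
    have h2 : G.dist z w ≠ 1 := fun h ↦ hadj (dist_eq_one_iff_adj.1 h)
    have h3 : G.dist z w ≠ 0 := fun h0 ↦ hz (h.1.1.dist_eq_zero_iff.1 h0 ▸ hw)
    omega
  have hsum := h.sum_line_cosine hgeo hb (by omega) hα hℓ z
  have hcardℓ : (ℓ.ncard : ℝ) = (Finset.univ.filter (· ∈ ℓ)).card := by
    rw [Set.ncard_eq_toFinset_card']
    congr 2
    ext
    simp
  have hsplit := Finset.card_filter_add_card_filter_not (s := Finset.univ.filter (· ∈ ℓ))
    (fun w ↦ G.Adj z w)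
  have hnear : {w | w ∈ ℓ ∧ G.Adj z w}.ncard =
      ((Finset.univ.filter (· ∈ ℓ)).filter fun w ↦ G.Adj z w).card := by
    rw [Set.ncard_eq_toFinset_card']
    congr 1
    ext
    simp
  rw [← hnear] at hsplit
  rw [← hsplit, hcard] at hcardℓ
  rw [← Finset.sum_filter_add_sum_filter_not _ (fun w ↦ G.Adj z w),
    Finset.sum_congr rfl (g := fun _ ↦ cosine b α β 1), Finset.sum_const, nsmul_eq_mul, ← hnear,
    Finset.sum_congr rfl (g := fun _ ↦ cosine b α β 2), Finset.sum_const, nsmul_eq_mul] at hsum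
  · push_cast at hcardℓ
    set n : ℝ := ({w | w ∈ ℓ ∧ G.Adj z w}.ncard : ℝ)
    have hu1' : cosine b α β 1 ≠ 0 := by
      intro h0
      rw [h0] at hu1
      norm_num at hu1
    have key : cosine b α β 1 * ((β + 1) * (n - (1 + α))) = 0 := by
      linear_combination (β - α) * hsum - (β + 1 - n) * hu2 + cosine b α β 2 * (β - α) * hcardℓ
    have hβ1 : β + 1 ≠ 0 := by positivity
    have := (mul_eq_zero.1 ((mul_eq_zero.1 key).resolve_left hu1')).resolve_left hβ1
    linarith
  · intro w hw
    simp only [Finset.mem_filter, Finset.mem_univ, true_and] at hw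
    rw [hdist w hw.1 hw.2]
  · intro w hw
    rw [dist_eq_one_iff_adj.2 (Finset.mem_filter.1 hw).2]

/-- The number of common neighbours of two adjacent vertices outside their common line. -/
lemma HasClassicalParams.ncard_common_off_line (h : HasClassicalParams G D b α β cc aa bb)
    (hgeo : IsGeomLineSet G (β + 1) 𝓒) (hℓ : ℓ ∈ 𝓒) {x y : V} (hxy : G.Adj x y) (hx : x ∈ ℓ)
    (hy : y ∈ ℓ) :
    ({z | G.Adj x z ∧ G.Adj y z ∧ z ∉ ℓ}.ncard : ℝ) = α * (gauss b D - 1) := by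
  obtain ⟨hclique, hcard⟩ := hgeo.1 ℓ hℓ
  have hdist := dist_eq_one_iff_adj.2 hxy
  have ha := h.aa_eq le_rfl hdist
  rw [← (h.1.2.2.2 1 (hdist ▸ h.1.2.1 x y) x y hdist).2.1, gauss_one, Nat.sub_self,
    gauss_zero] at ha
  have hunion : {z | G.Adj y z ∧ G.dist x z = 1} =
      {z | G.Adj x z ∧ G.Adj y z ∧ z ∉ ℓ} ∪ (ℓ \ {x}) \ {y} := by
    ext z
    simp only [Set.mem_ofPred_eq, dist_eq_one_iff_adj, Set.mem_union, Set.mem_sdiff,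
      Set.mem_singleton_iff]
    constructor
    · rintro ⟨hyz, hxz⟩
      by_cases hz : z ∈ ℓ
      · exact .inr ⟨⟨hz, hxz.ne'⟩, hyz.ne'⟩
      · exact .inl ⟨hxz, hyz, hz⟩
    · rintro (⟨hxz, hyz, -⟩ | ⟨⟨hz, hzx⟩, hzy⟩)
      · exact ⟨hyz, hxz⟩
      · exact ⟨hclique hy hz (Ne.symm hzy), hclique hx hz (Ne.symm hzx)⟩
  have hdisj : Disjoint {z | G.Adj x z ∧ G.Adj y z ∧ z ∉ ℓ} ((ℓ \ {x}) \ {y}) :=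
    Set.disjoint_left.2 fun z hz hz' ↦ hz.2.2 hz'.1.1
  have h1 := Set.ncard_sdiff_singleton_add_one hx (Set.toFinite ℓ)
  have h2 := Set.ncard_sdiff_singleton_add_one (s := ℓ \ {x}) (a := y) ⟨hy, hxy.ne'⟩
    (Set.toFinite _)
  rw [hunion, Set.ncard_union_eq hdisj] at ha
  rw [← h1, ← h2] at hcard
  push_cast at ha hcard
  linarith

end ClassicalParams

/-- Two members of an edge partition into cliques sharing two distinct vertices coincide. -/
lemma IsGeomLineSet.eq_of_mem {G : SimpleGraph V} {q : ℝ} {𝓒 : Set (Set V)}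
    (hgeo : IsGeomLineSet G q 𝓒) {ℓ m : Set V} (hℓ : ℓ ∈ 𝓒) (hm : m ∈ 𝓒) {x y : V} (hne : x ≠ y)
    (hxℓ : x ∈ ℓ) (hyℓ : y ∈ ℓ) (hxm : x ∈ m) (hym : y ∈ m) : ℓ = m :=
  (hgeo.2 x y ((hgeo.1 ℓ hℓ).1 hxℓ hyℓ hne)).unique ⟨hℓ, hxℓ, hyℓ⟩ ⟨hm, hxm, hym⟩

/-- Two common neighbours of the collinear vertices `x, y` off their line have the same
neighbours on that line. -/
lemma DualPasch.adj_of_adj {G : SimpleGraph V} {q : ℝ} {𝓒 : Set (Set V)}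
    (hpasch : DualPasch G 𝓒) (hgeo : IsGeomLineSet G q 𝓒) {ℓ : Set V} (hℓ : ℓ ∈ 𝓒)
    {x y z v w : V} (hxy : G.Adj x y) (hx : x ∈ ℓ) (hy : y ∈ ℓ)
    (hz : G.Adj x z ∧ G.Adj y z ∧ z ∉ ℓ) (hv : G.Adj x v ∧ G.Adj y v ∧ v ∉ ℓ) (hwℓ : w ∈ ℓ)
    (hzw : G.Adj z w) : G.Adj v w := by
  by_cases hvz : v = z
  · exact hvz ▸ hzw
  have hzv : G.Adj z v := hpasch x y hxy ℓ hℓ hx hy hz hv (Ne.symm hvz)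
  obtain ⟨hxz, hyz, hzℓ⟩ := hz
  obtain ⟨hxv, hyv, hvℓ⟩ := hv
  by_cases hwx : w = x
  · exact hwx ▸ hxv.symm
  by_cases hwy : w = y
  · exact hwy ▸ hyv.symm
  have hvw : v ≠ w := by rintro rfl; exact hvℓ hwℓ
  obtain ⟨m, ⟨hm, hxm, hzm⟩, -⟩ := hgeo.2 x z hxz
  obtain ⟨n, ⟨hn, hyn, hzn⟩, -⟩ := hgeo.2 y z hyz
  have hwm : w ∉ m := fun hwm ↦ hzℓ (hgeo.eq_of_mem hm hℓ hwx hwm hxm hwℓ hx ▸ hzm)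
  have hwn : w ∉ n := fun hwn ↦ hzℓ (hgeo.eq_of_mem hn hℓ hwy hwn hyn hwℓ hy ▸ hzn)
  have hxw : G.Adj x w := (hgeo.1 ℓ hℓ).1 hx hwℓ (Ne.symm hwx)
  have hyw : G.Adj y w := (hgeo.1 ℓ hℓ).1 hy hwℓ (Ne.symm hwy)
  by_cases hvm : v ∈ m
  · have hvn : v ∉ n := by
      intro hvn
      have hmn : m = n := hgeo.eq_of_mem hm hn hvz hvm hzm hvn hzn
      exact hzℓ (hgeo.eq_of_mem hm hℓ hxy.ne hxm (hmn ▸ hyn) hx hy ▸ hzm)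
    exact hpasch y z hyz n hn hyn hzn ⟨hyv, hzv, hvn⟩ ⟨hyw, hzw, hwn⟩ hvw
  · exact hpasch x z hxz m hm hxm hzm ⟨hxv, hzv, hvm⟩ ⟨hxw, hzw, hwm⟩ hvw

/-- For collinear `x, y` with line `ℓ` and a common neighbour `z` off `ℓ`, the common neighbours
of `x, y` off `ℓ` together with the neighbours of `z` on `ℓ` form the unique assembly containing
`x` and `y`. -/
lemma DualPasch.assembly_iff {G : SimpleGraph V} {q : ℝ} {𝓒 : Set (Set V)}
    (hpasch : DualPasch G 𝓒) (hgeo : IsGeomLineSet G q 𝓒) {ℓ : Set V} (hℓ : ℓ ∈ 𝓒) {x y z : V}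
    (hxy : G.Adj x y) (hx : x ∈ ℓ) (hy : y ∈ ℓ) (hz : G.Adj x z ∧ G.Adj y z ∧ z ∉ ℓ)
    (M : Set V) :
    IsAssembly G 𝓒 M ∧ x ∈ M ∧ y ∈ M ↔
      M = {w | G.Adj x w ∧ G.Adj y w ∧ w ∉ ℓ} ∪ {w | w ∈ ℓ ∧ G.Adj z w} := by
  set S : Set V := {w | G.Adj x w ∧ G.Adj y w ∧ w ∉ ℓ}
  set T : Set V := {w | w ∈ ℓ ∧ G.Adj z w}
  have hS : G.IsClique S := hpasch x y hxy ℓ hℓ hx hy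
  have hxT : x ∈ T := ⟨hx, hz.1.symm⟩
  have hyT : y ∈ T := ⟨hy, hz.2.1.symm⟩
  have hST (v : V) (hv : v ∈ S) (w : V) (hw : w ∈ T) : G.Adj v w :=
    hpasch.adj_of_adj hgeo hℓ hxy hx hy hz hv hw.1 hw.2
  have hclique : G.IsClique (S ∪ T) := by
    rintro v (hv | hv) w (hw | hw) hne
    · exact hS hv hw hne
    · exact hST v hv w hw
    · exact (hST w hw v hv).symm
    · exact (hgeo.1 ℓ hℓ).1 hv.1 hw.1 hne
  have hsub {t : Set V} (ht : G.IsClique t) (hxt : x ∈ t) (hyt : y ∈ t) {v : V} (hv : v ∈ t)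
      (hvℓ : v ∉ ℓ) : t ⊆ S ∪ T := by
    have hoff {w : V} (hw : w ∈ t) (hwℓ : w ∉ ℓ) : w ∈ S :=
      ⟨ht hxt hw (by rintro rfl; exact hwℓ hx), ht hyt hw (by rintro rfl; exact hwℓ hy), hwℓ⟩
    intro w hw
    by_cases hwℓ : w ∈ ℓ
    · have hvw : G.Adj v w := ht hv hw (by rintro rfl; exact hvℓ hwℓ)
      exact .inr ⟨hwℓ, hpasch.adj_of_adj hgeo hℓ hxy hx hy (hoff hv hvℓ) hz hwℓ hvw⟩
    · exact .inl (hoff hw hwℓ)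
  constructor
  · rintro ⟨⟨⟨hM, hmax⟩, hMC⟩, hxM, hyM⟩
    have hnot : ¬M ⊆ ℓ := fun hle ↦ hMC (hmax ℓ (hgeo.1 ℓ hℓ).1 hle ▸ hℓ)
    obtain ⟨v, hvM, hvℓ⟩ := Set.not_subset.1 hnot
    exact (hmax _ hclique (hsub hM hxM hyM hvM hvℓ)).symm
  · rintro rfl
    have hzM : z ∈ S ∪ T := .inl hz
    refine ⟨⟨⟨hclique, fun t ht hle ↦ ?_⟩, fun hmem ↦ ?_⟩, .inr hxT, .inr hyT⟩
    · exact (hsub ht (hle (.inr hxT)) (hle (.inr hyT)) (hle hzM) hz.2.2).antisymm hle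
    · exact hz.2.2 (hgeo.eq_of_mem hmem hℓ hxy.ne (.inr hxT) (.inr hyT) hx hy ▸ hzM)

/-- In a nonempty graph without isolated vertices every maximal clique contains an edge. -/
lemma IsMaxClique.exists_adj {G : SimpleGraph V} {M : Set V} (hM : IsMaxClique G M)
    (hne : Nonempty V) (hadj : ∀ x, ∃ y, G.Adj x y) :
    ∃ x y, G.Adj x y ∧ x ∈ M ∧ y ∈ M := by
  obtain ⟨x, hx⟩ : M.Nonempty := by
    by_contra hempty
    rw [Set.not_nonempty_iff_eq_empty] at hempty
    obtain ⟨x⟩ := hne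
    have := hM.2 {x} (Set.pairwise_singleton _ _) (hempty ▸ Set.empty_subset _)
    exact Set.singleton_ne_empty x (this.trans hempty)
  obtain ⟨y, hxy⟩ := hadj x
  by_cases hM' : M ⊆ {x}
  · have hedge : G.IsClique {x, y} := isClique_pair.2 fun _ ↦ hxy
    have heq := hM.2 {x, y} hedge fun w hw ↦ .inl (hM' hw)
    exact ⟨x, y, hxy, hx, heq ▸ .inr rfl⟩
  · obtain ⟨w, hw, hwx⟩ := Set.not_subset.1 hM'
    exact ⟨x, w, hM.1 hx hw (Ne.symm hwx), hx, hw⟩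

/-- for a geometric distance-regular graph with classical parameters
`(D, b, α, β)`, `b ≥ 2`, `1 ≤ α ≤ b - 1`, `D ≥ 3`, line set `𝓒` and `r = [D]`, satisfying
the dual Pasch axiom: each pair of adjacent vertices lies in a unique assembly, each assembly
has exactly `αr + 1` vertices, `β ≥ αr`, and each vertex lies in exactly `β/α` assemblies. -/
theorem statement_15 {V : Type*} [Fintype V] (G : SimpleGraph V) (D b : ℕ) (α β : ℝ)
    (cc aa bb : ℕ → ℕ) (hb : 2 ≤ b) (hD : 3 ≤ D)
    (hα : 1 ≤ α ∧ α ≤ (b : ℝ) - 1)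
    (h : HasClassicalParams G D b α β cc aa bb)
    (𝓒 : Set (Set V)) (hgeo : IsGeomLineSet G (β + 1) 𝓒)
    (hpasch : DualPasch G 𝓒) :
    (∀ x y : V, G.Adj x y → ∃! M : Set V, IsAssembly G 𝓒 M ∧ x ∈ M ∧ y ∈ M) ∧
    (∀ M : Set V, IsAssembly G 𝓒 M → (M.ncard : ℝ) = α * gauss b D + 1) ∧
    α * gauss b D ≤ β ∧
    (∀ x : V, ({M : Set V | IsAssembly G 𝓒 M ∧ x ∈ M}.ncard : ℝ) = β / α) := by
  have hb0 : 0 < b := by omega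
  have hα0 : 0 < α := by linarith [hα.1]
  have hβ : 0 < β := by simpa [gauss_zero] using h.mul_gauss_lt hb0 hα0.le (i := 0) (by omega)
  have hr : 1 < gauss b D := by
    have h2 := gauss_mono b (show 2 ≤ D by omega)
    rw [gauss_succ, gauss_one, pow_one] at h2
    have : (0 : ℝ) < b := by positivity
    linarith
  have hsize {x y : V} (hxy : G.Adj x y) : ∃ M : Set V, (M.ncard : ℝ) = α * gauss b D + 1 ∧
      ∀ M', IsAssembly G 𝓒 M' ∧ x ∈ M' ∧ y ∈ M' ↔ M' = M := by
    obtain ⟨ℓ, ⟨hℓ, hx, hy⟩, -⟩ := hgeo.2 x y hxy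
    have hS := h.ncard_common_off_line hgeo hℓ hxy hx hy
    have hpos : (0 : ℝ) < {z | G.Adj x z ∧ G.Adj y z ∧ z ∉ ℓ}.ncard := by
      rw [hS]
      exact mul_pos hα0 (by linarith)
    rw [Nat.cast_pos, Set.ncard_pos] at hpos
    obtain ⟨z, hz⟩ := hpos
    refine ⟨_, ?_, hpasch.assembly_iff hgeo hℓ hxy hx hy hz⟩
    rw [Set.ncard_union_eq (Set.disjoint_left.2 fun w hw hw' ↦ hw.2.2 hw'.1), Nat.cast_add, hS,
      h.ncard_adj_line hgeo hb0 (by omega) hα0.le hℓ hz.2.2 hx hz.1.symm]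
    ring
  have hunique : IsPointGraphOf G {M | IsAssembly G 𝓒 M} := fun x y hxy ↦ by
    obtain ⟨M, -, hM⟩ := hsize hxy
    exact ⟨M, (hM M).2 rfl, fun M' ↦ (hM M').1⟩
  have hcard (M : Set V) (hM : IsAssembly G 𝓒 M) : (M.ncard : ℝ) = α * gauss b D + 1 := by
    obtain ⟨x, y, hxy, hx, hy⟩ := hM.1.exists_adj h.1.1.nonempty fun x ↦ by
      have hdeg : (0 : ℝ) < {z | G.Adj x z}.ncard := by
        rw [h.degree_eq]
        positivity
      rw [Nat.cast_pos, Set.ncard_pos] at hdeg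
      exact hdeg
    obtain ⟨M', hM', hiff⟩ := hsize hxy
    rwa [(hiff M).1 ⟨hM, hx, hy⟩]
  have hthrough (x : V) : ({M | IsAssembly G 𝓒 M ∧ x ∈ M}.ncard : ℝ) = β / α := by
    have hdeg := degree_eq_mul_ncard_cliques (𝓛 := {M | IsAssembly G 𝓒 M})
      (fun M hM ↦ hM.1.1) hcard hunique x
    rw [h.degree_eq] at hdeg
    rw [eq_div_iff hα0.ne']
    refine mul_left_cancel₀ (show gauss b D ≠ 0 by positivity) (Eq.trans ?_ hdeg.symm)
    simp only [Set.mem_ofPred_eq]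
    ring
  refine ⟨hunique, hcard, ?_, hthrough⟩
  classical
  obtain ⟨x⟩ := h.1.1.nonempty
  have hsum := sum_sq_cliques_eq (𝓛 := {M | IsAssembly G 𝓒 M}) (fun M hM ↦ hM.1.1) hunique
    hthrough (h.sum_adj_cosine hb0 (by omega) hα0.le x)
  have hnonneg : 0 ≤ (β / α + -gauss b D) * ∑ y, cosine b α β (G.dist x y) ^ 2 :=
    hsum ▸ Finset.sum_nonneg fun _ _ ↦ sq_nonneg _
  have hpos : 0 < ∑ y, cosine b α β (G.dist x y) ^ 2 :=
    Finset.sum_pos' (fun _ _ ↦ sq_nonneg _) ⟨x, Finset.mem_univ x, by simp [cosine_zero]⟩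
  have hle := nonneg_of_mul_nonneg_left hnonneg hpos
  rw [mul_comm, ← le_div_iff₀ hα0]
  linarith
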